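/- Let 𝒜 be an f-algebra with a multiplicative unit e. If e is a finite element of 𝒜, then e is an order unit in 𝒜 and every element of 𝒜 is finite, totally finite and a difference of positive self-majorizing elements, i.e. Φ₁(𝒜) = Φ₂(𝒜) = Φ₃(𝒜) = 𝒜. -/

import Mathlib

namespace FiniteElementsPaper

/-- Product of `p` factors `φ 0 * φ 1 * ⋯ * φ (p-1)` in a (possibly non-unital)
multiplicative structure; junk value `0` when `p = 0`. -/
def mulProd {A : Type*} [Mul A] [Zero A] : (p : ℕ) → (Fin p → A) → A
  | 0, _ => 0
  | q + 1, φ => Fin.foldl q (fun acc i => acc * φ i.succ) (φ 0)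

/-- `p`-th power `a^p` (junk value `0` for `p = 0`). -/
def mpow {A : Type*} [Mul A] [Zero A] (a : A) (p : ℕ) : A :=
  mulProd p (fun _ => a)

/-- The set `Π_p(𝒜)` of all `p`-fold products. -/
def piSet (A : Type*) [Mul A] [Zero A] (p : ℕ) : Set A :=
  {x | ∃ φ : Fin p → A, x = mulProd p φ}

variable {A : Type*} [Lattice A] [AddCommGroup A] [Module ℝ A]

/-- `z` is a majorant of `φ`: `z ≥ 0` and for every `x` there is `c > 0` with
`|x| ⊓ n • |φ| ≤ c • z` for all `n`. -/
def IsMajorant (z φ : A) : Prop :=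
  0 ≤ z ∧ ∀ x : A, ∃ c : ℝ, 0 < c ∧ ∀ n : ℕ, |x| ⊓ n • |φ| ≤ c • z

/-- `φ` is a finite element. -/
def IsFiniteElt (φ : A) : Prop := ∃ z : A, IsMajorant z φ

/-- `φ` is a totally finite element: it has a majorant which is itself finite. -/
def IsTotallyFiniteElt (φ : A) : Prop := ∃ z : A, IsMajorant z φ ∧ IsFiniteElt z

/-- `φ` is self-majorizing: `|φ|` is a majorant of `φ`. -/
def IsSelfMajorizing (φ : A) : Prop := IsMajorant |φ| φ

/-- `φ ∈ Φ₃(A) = S₊(A) - S₊(A)`. -/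
def InPhi3 (φ : A) : Prop :=
  ∃ s t : A, 0 ≤ s ∧ 0 ≤ t ∧ IsSelfMajorizing s ∧ IsSelfMajorizing t ∧ φ = s - t

/-- `w` is a majorant of `φ` relative to the subset `S` (all lattice operations
computed in the ambient algebra). -/
def IsMajorantIn (S : Set A) (w φ : A) : Prop :=
  0 ≤ w ∧ ∀ x ∈ S, ∃ c : ℝ, 0 < c ∧ ∀ n : ℕ, |x| ⊓ n • |φ| ≤ c • w

/-- `φ` is a finite element of the sublattice `S` (majorant required to lie in `S`). -/
def IsFiniteEltIn (S : Set A) (φ : A) : Prop := ∃ w ∈ S, IsMajorantIn S w φ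

/-- `φ` is a totally finite element of the sublattice `S`. -/
def IsTotallyFiniteEltIn (S : Set A) (φ : A) : Prop :=
  ∃ w ∈ S, IsMajorantIn S w φ ∧ IsFiniteEltIn S w

/-- `φ` is self-majorizing in the sublattice `S`. -/
def IsSelfMajorizingIn (S : Set A) (φ : A) : Prop := IsMajorantIn S |φ| φ

/-- `φ ∈ Φ₃(S) = S₊(S) - S₊(S)` for the sublattice `S`. -/
def InPhi3In (S : Set A) (φ : A) : Prop :=
  ∃ s t : A, s ∈ S ∧ t ∈ S ∧ 0 ≤ s ∧ 0 ≤ t ∧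
    IsSelfMajorizingIn S s ∧ IsSelfMajorizingIn S t ∧ φ = s - t

variable (A) in
/-- Archimedean ℓ-algebra structure: an Archimedean vector lattice together with an
associative bilinear multiplication whose product of positive elements is positive. -/
structure IsLAlgebra [Mul A] : Prop where
  add_le_add_left : ∀ a b : A, a ≤ b → ∀ c : A, c + a ≤ c + b
  smul_le_smul : ∀ (r : ℝ) (a b : A), 0 ≤ r → a ≤ b → r • a ≤ r • b
  archimedean : ∀ a b : A, 0 ≤ a → (∀ n : ℕ, n • a ≤ b) → a = 0
  mul_assoc : ∀ a b c : A, a * b * c = a * (b * c)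
  left_distrib : ∀ a b c : A, a * (b + c) = a * b + a * c
  right_distrib : ∀ a b c : A, (a + b) * c = a * c + b * c
  smul_mul : ∀ (r : ℝ) (a b : A), (r • a) * b = r • (a * b)
  mul_smul : ∀ (r : ℝ) (a b : A), a * (r • b) = r • (a * b)
  mul_nonneg : ∀ a b : A, 0 ≤ a → 0 ≤ b → 0 ≤ a * b

variable (A) in
/-- A `d`-algebra: ℓ-algebra in which `a ⊓ b = 0` implies `(a*c) ⊓ (b*c) = (c*a) ⊓ (c*b) = 0`
for all `c ≥ 0`. -/
structure IsDAlgebra [Mul A] extends IsLAlgebra A : Prop where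
  d_prop : ∀ a b c : A, a ⊓ b = 0 → 0 ≤ c → (a * c) ⊓ (b * c) = 0 ∧ (c * a) ⊓ (c * b) = 0

variable (A) in
/-- An `f`-algebra: ℓ-algebra in which `a ⊓ b = 0` implies `(a*c) ⊓ b = (c*a) ⊓ b = 0`
for all `c ≥ 0`. -/
structure IsFAlgebra [Mul A] extends IsLAlgebra A : Prop where
  f_prop : ∀ a b c : A, a ⊓ b = 0 → 0 ≤ c → (a * c) ⊓ b = 0 ∧ (c * a) ⊓ b = 0

/-- `e` is a multiplicative unit. -/
def IsMulUnit [Mul A] (e : A) : Prop := ∀ a : A, a * e = a ∧ e * a = a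

/-- `e` is an order unit. -/
def IsOrderUnit (e : A) : Prop := 0 ≤ e ∧ ∀ x : A, ∃ l : ℝ, 0 ≤ l ∧ |x| ≤ l • e

variable (A) in
/-- The algebra is semiprime: `0` is its only nilpotent element. -/
def IsSemiprime [Mul A] [Zero A] : Prop :=
  ∀ (a : A) (n : ℕ), 0 < n → mpow a n = 0 → a = 0

variable (A) in
/-- The vector lattice is uniformly complete. -/
def UniformlyComplete : Prop :=
  ∀ u : A, 0 ≤ u → ∀ f : ℕ → A,
    (∀ ε : ℝ, 0 < ε → ∃ K : ℕ, ∀ m n : ℕ, K ≤ m → K ≤ n → |f m - f n| ≤ ε • u) →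
    ∃ a : A, ∀ ε : ℝ, 0 < ε → ∃ K : ℕ, ∀ n : ℕ, K ≤ n → |f n - a| ≤ ε • u

variable (A) in
/-- The weak factorization property: every element is dominated by a product. -/
def WeakFactorization [Mul A] : Prop := ∀ a : A, ∃ b c : A, a ≤ b * c


section

variable {A : Type*} [Lattice A] [AddCommGroup A] [Module ℝ A]

theorem IsLAlgebra.isOrderedAddMonoid [Mul A] (hA : IsLAlgebra A) : IsOrderedAddMonoid A where
  add_le_add_left a b h c := by
    simpa only [add_comm] using hA.add_le_add_left a b h c

theorem IsLAlgebra.posSMulMono [Mul A] (hA : IsLAlgebra A) : PosSMulMono ℝ A :=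
  ⟨fun r hr a b h => hA.smul_le_smul r a b hr h⟩

theorem IsLAlgebra.mul_sub [Mul A] (hA : IsLAlgebra A) (a b c : A) :
    a * (b - c) = a * b - a * c := by
  rw [eq_sub_iff_add_eq, ← hA.left_distrib, sub_add_cancel]

theorem IsLAlgebra.sub_mul [Mul A] (hA : IsLAlgebra A) (a b c : A) :
    (a - b) * c = a * c - b * c := by
  rw [eq_sub_iff_add_eq, ← hA.right_distrib, sub_add_cancel]

/-- The square of a difference from a multiple of the unit. -/
theorem IsLAlgebra.sub_smul_unit_sq [Mul A] (hA : IsLAlgebra A) {e : A} (he : IsMulUnit e)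
    (x : A) (r : ℝ) :
    (x - r • e) * (x - r • e) = x * x - (2 * r) • x + (r * r) • e := by
  rw [hA.mul_sub, hA.sub_mul, hA.sub_mul, hA.smul_mul, hA.mul_smul, hA.mul_smul, hA.smul_mul,
    (he x).1, (he x).2, (he e).1]
  module

theorem IsFAlgebra.mul_eq_zero_of_inf_eq_zero [Mul A] (hA : IsFAlgebra A) {a b : A}
    (h : a ⊓ b = 0) : a * b = 0 := by
  have ha : 0 ≤ a := h ▸ inf_le_left
  have hb : 0 ≤ b := h ▸ inf_le_right
  have h₁ : b ⊓ (a * b) = 0 := by rw [inf_comm]; exact (hA.f_prop a b b h hb).1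
  simpa using (hA.f_prop b (a * b) a h₁ ha).2

theorem IsFAlgebra.mul_self_nonneg [Mul A] (hA : IsFAlgebra A) (a : A) : 0 ≤ a * a := by
  have := hA.isOrderedAddMonoid
  have h : a⁺ ⊓ a⁻ = 0 := posPart_inf_negPart_eq_zero a
  have h₁ := hA.mul_eq_zero_of_inf_eq_zero h
  have h₂ := hA.mul_eq_zero_of_inf_eq_zero (inf_comm a⁻ a⁺ ▸ h)
  have h₃ : a * a = a⁺ * a⁺ + a⁻ * a⁻ := by
    conv_lhs => rw [← posPart_sub_negPart a]
    rw [hA.mul_sub, hA.sub_mul, hA.sub_mul, h₁, h₂]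
    abel
  rw [h₃]
  exact add_nonneg (hA.mul_nonneg _ _ (posPart_nonneg a) (posPart_nonneg a))
    (hA.mul_nonneg _ _ (negPart_nonneg a) (negPart_nonneg a))

theorem IsFAlgebra.unit_nonneg [Mul A] (hA : IsFAlgebra A) {e : A} (he : IsMulUnit e) :
    0 ≤ e := by
  simpa only [(he e).1] using hA.mul_self_nonneg e

/-- The excess of a positive element `x` over `n • e` is at most `n⁻¹ • x ^ 2`. -/
theorem IsFAlgebra.nsmul_posPart_sub_nsmul_unit_le [Mul A] (hA : IsFAlgebra A) {e : A}
    (he : IsMulUnit e) {x : A} (hx : 0 ≤ x) (n : ℕ) : n • (x - n • e)⁺ ≤ x * x := by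
  have := hA.isOrderedAddMonoid
  have := hA.posSMulMono
  have hsq := hA.mul_self_nonneg x
  rcases n.eq_zero_or_pos with rfl | hn
  · simpa using hsq
  have hn' : (0 : ℝ) < n := by exact_mod_cast hn
  simp only [← Nat.cast_smul_eq_nsmul ℝ]
  have key : (n : ℝ) • (x - (n : ℝ) • e) ≤ x * x := by
    have h₁ := hA.mul_self_nonneg (x - (n : ℝ) • e)
    rw [hA.sub_smul_unit_sq he] at h₁
    have h₂ : 0 ≤ (n : ℝ) • x := smul_nonneg hn'.le hx
    rw [← sub_nonneg]
    convert add_nonneg h₁ h₂ using 1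
    module
  have h : (x - (n : ℝ) • e)⁺ ≤ (n : ℝ)⁻¹ • (x * x) := by
    refine sup_le ?_ (smul_nonneg (inv_nonneg.2 hn'.le) hsq)
    simpa [smul_smul, hn'.ne'] using smul_le_smul_of_nonneg_left key (inv_nonneg.2 hn'.le)
  simpa [smul_smul, hn'.ne'] using smul_le_smul_of_nonneg_left h hn'.le

/-- The unit of an f-algebra is a weak order unit: a bound of all truncations of a positive
element by multiples of the unit bounds the element. -/
theorem IsFAlgebra.le_of_forall_inf_nsmul_unit_le [Mul A] (hA : IsFAlgebra A) {e : A}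
    (he : IsMulUnit e) {x y : A} (hx : 0 ≤ x) (h : ∀ n : ℕ, x ⊓ n • e ≤ y) : x ≤ y := by
  have := hA.isOrderedAddMonoid
  suffices (x - y)⁺ = 0 from sub_nonpos.1 (posPart_eq_zero.1 this)
  refine hA.archimedean _ (x * x) (posPart_nonneg _) fun n => ?_
  refine (nsmul_le_nsmul_right ?_ n).trans (hA.nsmul_posPart_sub_nsmul_unit_le he hx n)
  refine sup_le ?_ (posPart_nonneg _)
  have h₁ : x - x ⊓ n • e = (x - n • e)⁺ := by
    rw [sub_inf, sub_self, sup_comm, posPart_def]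
  exact h₁ ▸ sub_le_sub_left (h n) x

theorem IsFAlgebra.le_smul_unit_of_mul_self_le [Mul A] (hA : IsFAlgebra A) {e : A}
    (he : IsMulUnit e) {z : A} {c : ℝ} (hc : 0 < c) (h : z * z ≤ c • z) : z ≤ c • e := by
  have := hA.isOrderedAddMonoid
  have := hA.posSMulMono
  have h₁ := add_nonneg (hA.mul_self_nonneg (z - c • e)) (sub_nonneg.2 h)
  rw [hA.sub_smul_unit_sq he] at h₁
  have h₂ : 0 ≤ c⁻¹ • (z * z - (2 * c) • z + (c * c) • e + (c • z - z * z)) :=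
    smul_nonneg (inv_nonneg.2 hc.le) h₁
  rw [← sub_nonneg]
  convert h₂ using 1
  match_scalars <;> field_simp <;> ring

theorem IsFAlgebra.isOrderUnit_of_isFiniteElt [Mul A] (hA : IsFAlgebra A) {e : A}
    (he : IsMulUnit e) (hef : IsFiniteElt e) : IsOrderUnit e := by
  have := hA.isOrderedAddMonoid
  have := hA.posSMulMono
  have he₀ := hA.unit_nonneg he
  obtain ⟨z, -, hz⟩ := hef
  have bound : ∀ x : A, ∃ c : ℝ, 0 < c ∧ |x| ≤ c • z := fun x => by
    obtain ⟨c, hc, h⟩ := hz x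
    rw [abs_of_nonneg he₀] at h
    exact ⟨c, hc, hA.le_of_forall_inf_nsmul_unit_le he (abs_nonneg x) h⟩
  obtain ⟨c, hc, hcz⟩ := bound (z * z)
  have hze := hA.le_smul_unit_of_mul_self_le he hc ((le_abs_self _).trans hcz)
  refine ⟨he₀, fun x => ?_⟩
  obtain ⟨d, hd, hdx⟩ := bound x
  refine ⟨d * c, (mul_pos hd hc).le, hdx.trans ?_⟩
  rw [mul_smul]
  exact smul_le_smul_of_nonneg_left hze hd.le

/-- Anything above an order unit majorizes every element. -/
theorem IsOrderUnit.isMajorant_of_le [Mul A] (hA : IsLAlgebra A) {e z : A} (he : IsOrderUnit e)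
    (hz : e ≤ z) (φ : A) : IsMajorant z φ := by
  have := hA.isOrderedAddMonoid
  have := hA.posSMulMono
  have hz₀ : 0 ≤ z := he.1.trans hz
  refine ⟨hz₀, fun x => ?_⟩
  obtain ⟨l, hl, h⟩ := he.2 x
  refine ⟨l + 1, by positivity, fun n => inf_le_left.trans (h.trans ?_)⟩
  rw [add_smul, one_smul]
  exact (smul_le_smul_of_nonneg_left hz hl).trans (le_add_of_nonneg_right hz₀)

theorem IsOrderUnit.inPhi3 [Mul A] (hA : IsLAlgebra A) {e : A} (he : IsOrderUnit e) (a : A) :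
    InPhi3 a := by
  have := hA.isOrderedAddMonoid
  have := hA.posSMulMono
  have selfMaj : ∀ s : A, e ≤ s → IsSelfMajorizing s := fun s hs =>
    he.isMajorant_of_le hA (hs.trans (le_abs_self s)) s
  obtain ⟨l, hl, h⟩ := he.2 a
  have ht : e ≤ l • e + e := le_add_of_nonneg_left (smul_nonneg hl he.1)
  have hs : e ≤ (a + l • e) + e :=
    le_add_of_nonneg_left (neg_le_iff_add_nonneg'.1 ((neg_le_abs a).trans h))
  exact ⟨a + l • e + e, l • e + e, he.1.trans hs, he.1.trans ht, selfMaj _ hs, selfMaj _ ht,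
    by abel⟩

end

/-- In an f-algebra with a finite multiplicative unit `e`, the element `e` is an
order unit and `Φ₁(𝒜) = Φ₂(𝒜) = Φ₃(𝒜) = 𝒜`. -/
theorem stmt4 {A : Type*} [Lattice A] [AddCommGroup A] [Module ℝ A] [Mul A]
    (hA : IsFAlgebra A) (e : A) (hunit : IsMulUnit e) (hef : IsFiniteElt e) :
    IsOrderUnit e ∧ ∀ a : A, IsFiniteElt a ∧ IsTotallyFiniteElt a ∧ InPhi3 a := by
  have he := hA.isOrderUnit_of_isFiniteElt hunit hef
  have hmaj := he.isMajorant_of_le hA.toIsLAlgebra le_rfl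
  exact ⟨he, fun a => ⟨⟨e, hmaj a⟩, ⟨e, hmaj a, hef⟩, he.inPhi3 hA.toIsLAlgebra a⟩⟩

end FiniteElementsPaper
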